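/- Let ρ : ℝ⁴ → ℝ be a smooth function of the variables (x,y,z,t) satisfying identically both 2ρ_xt = (1/2)ρ_xxxx + 3(ρ_xx)² (the KdV equation in ρ-form) and 2ρ_xz = 2ρ_xx ρ_xy + (1/3)ρ_xxxy + (2/3)ρ_yt (the Bogoyavlensky equation in ρ-form). Then 2ρ_xxz = (1/2)ρ_xxxxy + 2ρ_xxx ρ_xy + 4ρ_xx ρ_xxy holds identically; equivalently, u := 2ρ_xx satisfies u_z = (1/4)u_xxy + (1/2)(2ρ_xy)·u_x + u·u_y, Bogoyavlensky's 2+1-dimensional equation with ∂_x^{-1}u_y interpreted as 2ρ_xy. -/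

import Mathlib

noncomputable section

/-- Partial derivative in the `k`-th coordinate direction. -/
def pd {n : ℕ} (k : Fin n) (f : (Fin n → ℝ) → ℝ) : (Fin n → ℝ) → ℝ :=
  fun x => deriv (fun t => f (Function.update x k t)) (x k)

open scoped ContDiff in
theorem pd_eq_fderiv {n : ℕ} (k : Fin n) {f : (Fin n → ℝ) → ℝ} (hf : ContDiff ℝ ∞ f) :
    pd k f = fun x => fderiv ℝ f x (Pi.single k 1) := by
  funext x
  have hd : HasFDerivAt f (fderiv ℝ f x) (Function.update x k (x k)) := by
    rw [Function.update_eq_self]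
    exact (hf.differentiable (by simp) x).hasFDerivAt
  exact (hd.comp_hasDerivAt (x k) (hasDerivAt_update x k (x k))).deriv

open scoped ContDiff in
theorem ContDiff.pd {n : ℕ} (k : Fin n) {f : (Fin n → ℝ) → ℝ} (hf : ContDiff ℝ ∞ f) :
    ContDiff ℝ ∞ (pd k f) := by
  rw [pd_eq_fderiv k hf]
  exact (hf.fderiv_right (by simp)).clm_apply contDiff_const

open scoped ContDiff in
theorem pd_comm {n : ℕ} (j k : Fin n) {f : (Fin n → ℝ) → ℝ} (hf : ContDiff ℝ ∞ f) :
    pd j (pd k f) = pd k (pd j f) := by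
  have key (i l : Fin n) (x : Fin n → ℝ) :
      pd i (pd l f) x = fderiv ℝ (fderiv ℝ f) x (Pi.single i 1) (Pi.single l 1) := by
    have hd : DifferentiableAt ℝ (fderiv ℝ f) x :=
      (hf.fderiv_right (m := ∞) (by simp)).differentiable (by simp) x
    rw [pd_eq_fderiv i (hf.pd l), pd_eq_fderiv l hf]
    simp [fderiv_clm_apply hd (differentiableAt_const _)]
  funext x
  rw [key, key]
  exact (hf.contDiffAt.isSymmSndFDerivAt (by simpa using WithTop.coe_le_coe.2 (le_top (a := (2 : ℕ∞))))) _ _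

open scoped ContDiff in
theorem pd_add {n : ℕ} (k : Fin n) {f g : (Fin n → ℝ) → ℝ} (hf : ContDiff ℝ ∞ f)
    (hg : ContDiff ℝ ∞ g) : pd k (fun x => f x + g x) = fun x => pd k f x + pd k g x := by
  funext x
  rw [pd_eq_fderiv k (hf.add hg), pd_eq_fderiv k hf, pd_eq_fderiv k hg]
  simp [fderiv_fun_add (hf.differentiable (by simp) x) (hg.differentiable (by simp) x)]

open scoped ContDiff in
theorem pd_mul {n : ℕ} (k : Fin n) {f g : (Fin n → ℝ) → ℝ} (hf : ContDiff ℝ ∞ f)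
    (hg : ContDiff ℝ ∞ g) :
    pd k (fun x => f x * g x) = fun x => f x * pd k g x + g x * pd k f x := by
  funext x
  rw [pd_eq_fderiv k (hf.mul hg), pd_eq_fderiv k hf, pd_eq_fderiv k hg]
  simp [fderiv_fun_mul (hf.differentiable (by simp) x) (hg.differentiable (by simp) x)]

theorem pd_const_mul {n : ℕ} (k : Fin n) (c : ℝ) (f : (Fin n → ℝ) → ℝ) :
    pd k (fun x => c * f x) = fun x => c * pd k f x := by
  funext x
  simp [pd]

/-- for smooth `ρ : ℝ⁴ → ℝ` (coordinates `x = 0`, `y = 1`, `z = 2`,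
`t = 3`) satisfying the KdV equation `2ρ_xt = (1/2)ρ_xxxx + 3(ρ_xx)²` and the
Bogoyavlensky equation `2ρ_xz = 2ρ_xx ρ_xy + (1/3)ρ_xxxy + (2/3)ρ_yt`, one has
`2ρ_xxz = (1/2)ρ_xxxxy + 2ρ_xxx ρ_xy + 4ρ_xx ρ_xxy`; equivalently `u := 2ρ_xx`
satisfies `u_z = (1/4)u_xxy + (1/2)(2ρ_xy)·u_x + u·u_y`. -/
theorem statement5 (ρ : (Fin 4 → ℝ) → ℝ) (hρ : ContDiff ℝ (⊤ : ℕ∞) ρ)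
    (hKdV : ∀ p, 2 * pd 0 (pd 3 ρ) p
      = (1/2) * pd 0 (pd 0 (pd 0 (pd 0 ρ))) p + 3 * (pd 0 (pd 0 ρ) p) ^ 2)
    (hBog : ∀ p, 2 * pd 0 (pd 2 ρ) p
      = 2 * pd 0 (pd 0 ρ) p * pd 0 (pd 1 ρ) p
        + (1/3) * pd 0 (pd 0 (pd 0 (pd 1 ρ))) p + (2/3) * pd 1 (pd 3 ρ) p)
    (u : (Fin 4 → ℝ) → ℝ) (hu : u = fun p => 2 * pd 0 (pd 0 ρ) p) :
    (∀ p, 2 * pd 0 (pd 0 (pd 2 ρ)) p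
        = (1/2) * pd 0 (pd 0 (pd 0 (pd 0 (pd 1 ρ)))) p
          + 2 * pd 0 (pd 0 (pd 0 ρ)) p * pd 0 (pd 1 ρ) p
          + 4 * pd 0 (pd 0 ρ) p * pd 0 (pd 0 (pd 1 ρ)) p)
    ∧ (∀ p, pd 2 u p
        = (1/4) * pd 0 (pd 0 (pd 1 u)) p
          + (1/2) * (2 * pd 0 (pd 1 ρ) p) * pd 0 u p + u p * pd 1 u p) := by
  have hxx := (hρ.pd 0).pd 0
  have hxy := (hρ.pd 1).pd 0
  have hyx (f : (Fin 4 → ℝ) → ℝ) (hf : ContDiff ℝ (⊤ : ℕ∞) f) := pd_comm 1 0 hf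
  have hzx (f : (Fin 4 → ℝ) → ℝ) (hf : ContDiff ℝ (⊤ : ℕ∞) f) := pd_comm 2 0 hf
  have hxxy : pd 1 (pd 0 (pd 0 ρ)) = pd 0 (pd 0 (pd 1 ρ)) := by
    rw [hyx _ (hρ.pd 0), hyx _ hρ]
  have hxxz : pd 2 (pd 0 (pd 0 ρ)) = pd 0 (pd 0 (pd 2 ρ)) := by
    rw [hzx _ (hρ.pd 0), hzx _ hρ]
  have hxxxxy : pd 1 (pd 0 (pd 0 (pd 0 (pd 0 ρ)))) = pd 0 (pd 0 (pd 0 (pd 0 (pd 1 ρ)))) := by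
    rw [hyx _ (hxx.pd 0), hyx _ hxx, hxxy]
  have main : ∀ p, 2 * pd 0 (pd 0 (pd 2 ρ)) p
        = (1/2) * pd 0 (pd 0 (pd 0 (pd 0 (pd 1 ρ)))) p
          + 2 * pd 0 (pd 0 (pd 0 ρ)) p * pd 0 (pd 1 ρ) p
          + 4 * pd 0 (pd 0 ρ) p * pd 0 (pd 0 (pd 1 ρ)) p := by
    intro p
    have h1 := congrFun (congrArg (pd 1) (funext hKdV)) p
    have h2 := congrFun (congrArg (pd 0) (funext hBog)) p
    simp only [pow_two] at h1
    rw [pd_const_mul, pd_add 1 (contDiff_const.mul ((hxx.pd 0).pd 0))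
      (contDiff_const.mul (hxx.mul hxx)), pd_const_mul, pd_const_mul, pd_mul 1 hxx hxx,
      hxxxxy, hxxy, hyx _ (hρ.pd 3)] at h1
    rw [pd_const_mul, pd_add 0 (((contDiff_const.mul hxx).mul hxy).add
      (contDiff_const.mul ((hxy.pd 0).pd 0))) (contDiff_const.mul ((hρ.pd 3).pd 1)),
      pd_add 0 ((contDiff_const.mul hxx).mul hxy) (contDiff_const.mul ((hxy.pd 0).pd 0)),
      pd_mul 0 (contDiff_const.mul hxx) hxy, pd_const_mul, pd_const_mul, pd_const_mul] at h2
    linear_combination h2 + (1/3) * h1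
  refine ⟨main, fun p => ?_⟩
  subst hu
  simp only [pd_const_mul, hxxy, hxxz]
  linear_combination main p
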